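/- Let (A^{p,q}, d', d'') be a totally bounded double complex of complex vector spaces. Suppose that for every (p,q) ∈ ℤ² the space H_A^{p,q} is finite dimensional, that for every k ∈ ℤ the space H^k is finite dimensional, and that Σ_{p+q=k} dim_ℂ H_A^{p,q} = dim_ℂ H^k for every k. Then the double complex satisfies the d'd''-lemma, i.e., for every (p,q): Im d' ∩ ker d'' ∩ A^{p,q} = ker d' ∩ Im d'' ∩ A^{p,q} = Im d'd'' ∩ A^{p,q}. -/

import Mathlib

open Submodule

/-- A double complex of complex vector spaces, realized as an internally bigraded
module `W = ⊕_{p,q} A p q` together with global differentials `d'`, `d''` of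
bidegrees `(1,0)` and `(0,1)` satisfying `d'∘d' = 0`, `d''∘d'' = 0` and
`d'∘d'' + d''∘d' = 0`. -/
structure BiComplex (W : Type*) [AddCommGroup W] [Module ℂ W] where
  A : ℤ → ℤ → Submodule ℂ W
  d' : W →ₗ[ℂ] W
  d'' : W →ₗ[ℂ] W
  internal : DirectSum.IsInternal (fun pq : ℤ × ℤ => A pq.1 pq.2)
  map_d' : ∀ p q : ℤ, (A p q).map d' ≤ A (p + 1) q
  map_d'' : ∀ p q : ℤ, (A p q).map d'' ≤ A p (q + 1)
  d'_sq : d' ∘ₗ d' = 0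
  d''_sq : d'' ∘ₗ d'' = 0
  anticomm : d' ∘ₗ d'' + d'' ∘ₗ d' = 0

namespace BiComplex

variable {W : Type*} [AddCommGroup W] [Module ℂ W] (C : BiComplex W)

/-- `ker d' ∩ A^{p,q}` : the kernel of `d' : A^{p,q} → A^{p+1,q}`. -/
def kerd' (p q : ℤ) : Submodule ℂ W := LinearMap.ker C.d' ⊓ C.A p q

/-- `ker d'' ∩ A^{p,q}` : the kernel of `d'' : A^{p,q} → A^{p,q+1}`. -/
def kerd'' (p q : ℤ) : Submodule ℂ W := LinearMap.ker C.d'' ⊓ C.A p q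

/-- `Im d' ∩ A^{p,q} = d'(A^{p-1,q})`. -/
def imd' (p q : ℤ) : Submodule ℂ W := (C.A (p - 1) q).map C.d'

/-- `Im d'' ∩ A^{p,q} = d''(A^{p,q-1})`. -/
def imd'' (p q : ℤ) : Submodule ℂ W := (C.A p (q - 1)).map C.d''

/-- `Im d'd'' ∩ A^{p,q} = (d'∘d'')(A^{p-1,q-1})`. -/
def imd'd'' (p q : ℤ) : Submodule ℂ W := (C.A (p - 1) (q - 1)).map (C.d' ∘ₗ C.d'')

/-- `ker d'd'' ∩ A^{p,q}` : the kernel of `d'∘d'' : A^{p,q} → A^{p+1,q+1}`. -/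
def kerd'd'' (p q : ℤ) : Submodule ℂ W := LinearMap.ker (C.d' ∘ₗ C.d'') ⊓ C.A p q

/-- The `d'd''`-lemma at `(p,q)`:
`Im d' ∩ ker d'' ∩ A^{p,q} = ker d' ∩ Im d'' ∩ A^{p,q} = Im d'd'' ∩ A^{p,q}`. -/
def DDLemmaAt (p q : ℤ) : Prop :=
  C.imd' p q ⊓ C.kerd'' p q = C.imd'd'' p q ∧ C.kerd' p q ⊓ C.imd'' p q = C.imd'd'' p q

/-- The total-degree piece `A^k = ⊕_{p+q=k} A^{p,q}`. -/
def Atot (k : ℤ) : Submodule ℂ W := ⨆ p : ℤ, C.A p (k - p)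

/-- The total differential `d = d' + d''`. -/
def dtot : W →ₗ[ℂ] W := C.d' + C.d''

/-- `ker d ∩ A^k` : the kernel of `d : A^k → A^{k+1}`. -/
def kerdTot (k : ℤ) : Submodule ℂ W := LinearMap.ker C.dtot ⊓ C.Atot k

/-- `Im d ∩ A^k = d(A^{k-1})`. -/
def imdTot (k : ℤ) : Submodule ℂ W := (C.Atot (k - 1)).map C.dtot

/-- `ker d' ∩ ker d'' ∩ A^k = ⊕_{p+q=k} (ker d' ∩ ker d'' ∩ A^{p,q})`. -/
def kerd'kerd''Tot (k : ℤ) : Submodule ℂ W :=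
  ⨆ p : ℤ, (C.kerd' p (k - p) ⊓ C.kerd'' p (k - p))

/-- `Im d'd'' ∩ A^k = ⊕_{p+q=k} (Im d'd'' ∩ A^{p,q})`. -/
def imd'd''Tot (k : ℤ) : Submodule ℂ W := ⨆ p : ℤ, C.imd'd'' p (k - p)

/-- `ker d'd'' ∩ A^k = ⊕_{p+q=k} (ker d'd'' ∩ A^{p,q})`. -/
def kerd'd''Tot (k : ℤ) : Submodule ℂ W := ⨆ p : ℤ, C.kerd'd'' p (k - p)

/-- `Im d' ∩ A^k = ⊕_{p+q=k} (Im d' ∩ A^{p,q})`. -/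
def imd'Tot (k : ℤ) : Submodule ℂ W := ⨆ p : ℤ, C.imd' p (k - p)

/-- `Im d'' ∩ A^k = ⊕_{p+q=k} (Im d'' ∩ A^{p,q})`. -/
def imd''Tot (k : ℤ) : Submodule ℂ W := ⨆ p : ℤ, C.imd'' p (k - p)

/-- The double complex is totally bounded: `A^{p,q} = 0` for `|p| > N` or `|q| > N`. -/
def TotallyBounded : Prop :=
  ∃ N : ℕ, ∀ p q : ℤ, ((N : ℤ) < |p| ∨ (N : ℤ) < |q|) → C.A p q = ⊥

end BiComplex

/-- The quotient vector space `S / T` of a submodule `S` by (the trace of) a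
submodule `T ≤ S`. -/
abbrev quotSub {W : Type*} [AddCommGroup W] [Module ℂ W] (S T : Submodule ℂ W) :=
  S ⧸ (Submodule.comap S.subtype T)

namespace BiComplex

variable {W : Type*} [AddCommGroup W] [Module ℂ W] (C : BiComplex W)

/-- The projection of `W` onto its component of bidegree `(p, q)`. -/
noncomputable def proj (p q : ℤ) : W →ₗ[ℂ] W :=
  (C.A p q).subtype ∘ₗ
    DirectSum.component ℂ (ℤ × ℤ) (fun pq : ℤ × ℤ => C.A pq.1 pq.2) (p, q) ∘ₗ
    (LinearEquiv.ofBijective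
      (DirectSum.coeLinearMap (fun pq : ℤ × ℤ => C.A pq.1 pq.2)) C.internal).symm.toLinearMap

variable {C}

theorem proj_mem (p q : ℤ) (x : W) : C.proj p q x ∈ C.A p q := by
  simp only [proj, LinearMap.comp_apply]
  exact Subtype.property _

theorem decompose_symm_of_mem {p q : ℤ} {x : W} (hx : x ∈ C.A p q) :
    (LinearEquiv.ofBijective
      (DirectSum.coeLinearMap (fun pq : ℤ × ℤ => C.A pq.1 pq.2)) C.internal).symm x =
      DirectSum.lof ℂ (ℤ × ℤ) (fun pq : ℤ × ℤ => C.A pq.1 pq.2) (p, q) ⟨x, hx⟩ := by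
  rw [LinearEquiv.symm_apply_eq]
  exact (DirectSum.coeLinearMap_lof (fun pq : ℤ × ℤ => C.A pq.1 pq.2) (p, q) ⟨x, hx⟩).symm

theorem proj_of_mem {p q : ℤ} {x : W} (hx : x ∈ C.A p q) : C.proj p q x = x := by
  simp only [proj, LinearMap.comp_apply, LinearEquiv.coe_coe, decompose_symm_of_mem hx,
    DirectSum.component.lof_self]
  rfl

theorem proj_of_mem_of_ne {p q p' q' : ℤ} {x : W} (hx : x ∈ C.A p' q')
    (hne : (p', q') ≠ (p, q)) : C.proj p q x = 0 := by
  simp only [proj, LinearMap.comp_apply, LinearEquiv.coe_coe, decompose_symm_of_mem hx,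
    DirectSum.component.of, dif_neg hne, map_zero]

theorem ext_proj {x y : W} (h : ∀ p q, C.proj p q x = C.proj p q y) : x = y := by
  apply (LinearEquiv.ofBijective
    (DirectSum.coeLinearMap (fun pq : ℤ × ℤ => C.A pq.1 pq.2)) C.internal).symm.injective
  refine DFinsupp.ext fun pq => Subtype.ext (h pq.1 pq.2)

/-- To prove a linear identity on `W` it suffices to check it on homogeneous elements. -/
theorem linearMap_ext {f g : W →ₗ[ℂ] W}
    (h : ∀ p q, ∀ x ∈ C.A p q, f x = g x) : f = g := by
  ext x
  have hx : x ∈ ⨆ pq : ℤ × ℤ, C.A pq.1 pq.2 := by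
    rw [C.internal.submodule_iSup_eq_top]; trivial
  induction hx using Submodule.iSup_induction' with
  | mem pq y hy => exact h _ _ y hy
  | zero => simp
  | add y z _ _ hy hz => simp [hy, hz]

theorem d'_mem {p q : ℤ} {x : W} (hx : x ∈ C.A p q) : C.d' x ∈ C.A (p + 1) q :=
  C.map_d' p q (Submodule.mem_map_of_mem hx)

theorem d''_mem {p q : ℤ} {x : W} (hx : x ∈ C.A p q) : C.d'' x ∈ C.A p (q + 1) :=
  C.map_d'' p q (Submodule.mem_map_of_mem hx)

theorem d'_d' (x : W) : C.d' (C.d' x) = 0 := LinearMap.congr_fun C.d'_sq x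

theorem d''_d'' (x : W) : C.d'' (C.d'' x) = 0 := LinearMap.congr_fun C.d''_sq x

theorem d''_d' (x : W) : C.d'' (C.d' x) = -C.d' (C.d'' x) :=
  eq_neg_of_add_eq_zero_right (LinearMap.congr_fun C.anticomm x)

theorem proj_d' (p q : ℤ) (x : W) : C.proj (p + 1) q (C.d' x) = C.d' (C.proj p q x) := by
  have : C.proj (p + 1) q ∘ₗ C.d' = C.d' ∘ₗ C.proj p q := by
    refine linearMap_ext (C := C) fun r s y hy => ?_
    simp only [LinearMap.comp_apply]
    by_cases h : (r, s) = (p, q)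
    · obtain ⟨rfl, rfl⟩ := Prod.mk.inj h
      rw [proj_of_mem hy, proj_of_mem (d'_mem hy)]
    · rw [proj_of_mem_of_ne hy h, map_zero, proj_of_mem_of_ne (d'_mem hy)]
      simpa using h
  exact LinearMap.congr_fun this x

theorem proj_d'' (p q : ℤ) (x : W) : C.proj p (q + 1) (C.d'' x) = C.d'' (C.proj p q x) := by
  have : C.proj p (q + 1) ∘ₗ C.d'' = C.d'' ∘ₗ C.proj p q := by
    refine linearMap_ext (C := C) fun r s y hy => ?_
    simp only [LinearMap.comp_apply]
    by_cases h : (r, s) = (p, q)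
    · obtain ⟨rfl, rfl⟩ := Prod.mk.inj h
      rw [proj_of_mem hy, proj_of_mem (d''_mem hy)]
    · rw [proj_of_mem_of_ne hy h, map_zero, proj_of_mem_of_ne (d''_mem hy)]
      simpa using h
  exact LinearMap.congr_fun this x

theorem proj_dtot (p q : ℤ) (x : W) :
    C.proj (p + 1) (q + 1) (C.dtot x) =
      C.d' (C.proj p (q + 1) x) + C.d'' (C.proj (p + 1) q x) := by
  simp [dtot, proj_d', proj_d'']

theorem proj_of_mem_Atot {k p q : ℤ} {x : W} (hx : x ∈ C.Atot k) (h : p + q ≠ k) :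
    C.proj p q x = 0 := by
  have : C.Atot k ≤ LinearMap.ker (C.proj p q) := by
    refine iSup_le fun r y hy => proj_of_mem_of_ne hy fun e => h ?_
    obtain ⟨rfl, rfl⟩ := Prod.mk.inj e
    ring
  exact this hx

theorem A_le_Atot {p q k : ℤ} (h : p + q = k) : C.A p q ≤ C.Atot k := by
  obtain rfl : q = k - p := by omega
  exact le_iSup (fun p => C.A p (k - p)) p

theorem dtot_mem_Atot {k : ℤ} {x : W} (hx : x ∈ C.Atot k) : C.dtot x ∈ C.Atot (k + 1) := by
  have : C.Atot k ≤ (C.Atot (k + 1)).comap C.dtot := by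
    refine iSup_le fun p y hy => Submodule.mem_comap.2 ?_
    refine add_mem (a := C.d' y) (b := C.d'' y) ?_ ?_
    · exact A_le_Atot (by ring) (d'_mem hy)
    · exact A_le_Atot (by ring) (d''_mem hy)
  exact this hx

/-- In a bounded double complex, every family of elements of bidegrees `(p, k - p)` consists of
the components of an element of total degree `k`. -/
theorem exists_mem_Atot_proj_eq (hbd : C.TotallyBounded) {k : ℤ} (f : ℤ → W)
    (hf : ∀ p q, p + q = k → f p ∈ C.A p q) :
    ∃ w ∈ C.Atot k, ∀ p q, p + q = k → C.proj p q w = f p := by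
  obtain ⟨N, hN⟩ := hbd
  refine ⟨∑ p ∈ Finset.Icc (-(N : ℤ)) N, f p,
    Submodule.sum_mem _ fun p _ => A_le_Atot (add_sub_cancel p k) (hf p _ (by ring)), ?_⟩
  intro p q hpq
  rw [map_sum, Finset.sum_eq_single p]
  · exact proj_of_mem (hf p q hpq)
  · intro r _ hr
    exact proj_of_mem_of_ne (hf r (k - r) (by ring)) fun e => hr (Prod.mk.inj e).1
  · intro hp
    have h0 := hf p q hpq
    rw [hN p q (Or.inl (by rw [Finset.mem_Icc, ← abs_le] at hp; omega)),
      Submodule.mem_bot] at h0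
    rw [h0, map_zero]

/-- Injectivity of the natural map from total cohomology of degree `k` to Aeppli cohomology. -/
def AeppliInjective (C : BiComplex W) (k : ℤ) : Prop :=
  ∀ z ∈ C.kerdTot k, (∀ p q, p + q = k → C.proj p q z ∈ C.imd' p q ⊔ C.imd'' p q) →
    z ∈ C.imdTot k

/-- Surjectivity of the natural map from total cohomology of degree `k` to Aeppli cohomology. -/
def AeppliSurjective (C : BiComplex W) (k : ℤ) : Prop :=
  ∀ c : ℤ → W, (∀ p q, p + q = k → c p ∈ C.kerd'd'' p q) →
    ∃ z ∈ C.kerdTot k, ∀ p q, p + q = k → C.proj p q z - c p ∈ C.imd' p q ⊔ C.imd'' p q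

/-- In total degree `k`, both differentials map `ker d'd''` into `Im d'd''`. -/
def DDImage (C : BiComplex W) (k : ℤ) : Prop :=
  ∀ p q, p + q = k → ∀ x ∈ C.kerd'd'' p q,
    (∃ e ∈ C.A p (q - 1), C.d' x = C.d' (C.d'' e)) ∧
      ∃ e ∈ C.A (p - 1) q, C.d'' x = C.d' (C.d'' e)

theorem exists_of_mem_imd'_sup_imd'' {p q : ℤ} {x : W} (hx : x ∈ C.imd' p q ⊔ C.imd'' p q) :
    ∃ a ∈ C.A (p - 1) q, ∃ b ∈ C.A p (q - 1), x = C.d' a + C.d'' b := by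
  obtain ⟨_, ⟨a, ha, rfl⟩, _, ⟨b, hb, rfl⟩, h⟩ := Submodule.mem_sup.1 hx
  exact ⟨a, ha, b, hb, h.symm⟩

theorem d'_proj_add_d''_proj {k : ℤ} {z : W} (hz : z ∈ C.kerdTot k) {p q : ℤ} :
    C.d' (C.proj (p - 1) q z) + C.d'' (C.proj p (q - 1) z) = 0 := by
  have h := proj_dtot (C := C) (p - 1) (q - 1) z
  rw [show C.dtot z = 0 from hz.1] at h
  simpa using h.symm

theorem AeppliSurjective.ddImage {k : ℤ} (h : C.AeppliSurjective k) : C.DDImage k := by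
  intro p q hpq x hx
  have hc : ∀ r s, r + s = k → (Pi.single p x : ℤ → W) r ∈ C.kerd'd'' r s := by
    intro r s hrs
    by_cases hr : r = p
    · subst hr
      obtain rfl : s = q := by omega
      simpa using hx
    · simp [Pi.single_eq_of_ne hr]
  obtain ⟨z, hz, hzc⟩ := h (Pi.single p x) hc
  obtain ⟨a, ha, b, hb, hab⟩ := exists_of_mem_imd'_sup_imd'' (hzc p q hpq)
  rw [Pi.single_eq_same, sub_eq_iff_eq_add] at hab
  constructor
  · obtain ⟨a', ha', b', hb', hab'⟩ :=
      exists_of_mem_imd'_sup_imd'' (hzc (p + 1) (q - 1) (by omega))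
    rw [Pi.single_eq_of_ne (by omega), sub_zero] at hab'
    rw [add_sub_cancel_right] at ha'
    refine ⟨a' - b, sub_mem ha' hb, ?_⟩
    have key := d'_proj_add_d''_proj hz (p := p + 1) (q := q)
    rw [add_sub_cancel_right, hab, hab'] at key
    simp only [map_add, d'_d', d''_d'', d''_d', zero_add, add_zero] at key
    simp only [map_sub]
    linear_combination (norm := module) key
  · obtain ⟨a', ha', b', hb', hab'⟩ :=
      exists_of_mem_imd'_sup_imd'' (hzc (p - 1) (q + 1) (by omega))
    rw [Pi.single_eq_of_ne (by omega), sub_zero] at hab'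
    rw [add_sub_cancel_right] at hb'
    refine ⟨a - b', sub_mem ha hb', ?_⟩
    have key := d'_proj_add_d''_proj hz (p := p) (q := q + 1)
    rw [add_sub_cancel_right, hab, hab'] at key
    simp only [map_add, d'_d', d''_d'', d''_d', zero_add, add_zero] at key
    simp only [map_sub]
    linear_combination (norm := module) key

theorem DDImage.aeppliInjective_succ (hbd : C.TotallyBounded) {k : ℤ} (h : C.DDImage k) :
    C.AeppliInjective (k + 1) := by
  intro z hz hzp
  have hex : ∀ p, ∃ a b, a ∈ C.A (p - 1) (k + 1 - p) ∧ b ∈ C.A p (k - p) ∧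
      C.proj p (k + 1 - p) z = C.d' a + C.d'' b := by
    intro p
    obtain ⟨a, ha, b, hb, hab⟩ := exists_of_mem_imd'_sup_imd'' (hzp p (k + 1 - p) (by ring))
    exact ⟨a, b, ha, by convert hb using 2; ring, hab⟩
  choose a b ha hb hab using hex
  have hc : ∀ p, a (p + 1) - b p ∈ C.kerd'd'' p (k - p) := by
    intro p
    refine ⟨?_, sub_mem ?_ (hb p)⟩
    · have key := d'_proj_add_d''_proj hz (p := p + 1) (q := k + 1 - p)
      have h1 := hab (p + 1)
      rw [show k + 1 - (p + 1) = k + 1 - p - 1 by ring] at h1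
      rw [add_sub_cancel_right, hab p, h1] at key
      simp only [map_add, d'_d', d''_d'', d''_d', zero_add, add_zero] at key
      change C.d' (C.d'' (a (p + 1) - b p)) = 0
      simp only [map_sub]
      linear_combination (norm := module) -key
    · convert ha (p + 1) using 2 <;> ring
  have hex := fun p => (h p (k - p) (by ring) _ (hc p)).1
  choose e he hde using hex
  obtain ⟨w, hw, hwp⟩ := exists_mem_Atot_proj_eq hbd (k := k) (fun p => b p + C.d'' (e p)) (by
    intro p q hpq
    obtain rfl : q = k - p := by omega
    exact add_mem (hb p) (by simpa using d''_mem (he p)))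
  refine ⟨w, by simpa using hw, ext_proj (C := C) fun p q => ?_⟩
  by_cases hpq : p + q = k + 1
  · have h1 := proj_dtot (C := C) (p - 1) (q - 1) w
    simp only [sub_add_cancel] at h1
    obtain rfl : q = k + 1 - p := by omega
    rw [h1, hwp _ _ (by ring), hwp _ _ (by ring), hab p]
    have h2 := hde (p - 1)
    simp only [sub_add_cancel, map_sub] at h2
    simp only [map_add, d''_d'', add_zero]
    linear_combination (norm := module) -h2
  · rw [proj_of_mem_Atot (dtot_mem_Atot hw) hpq, proj_of_mem_Atot hz.2 hpq]

theorem proj_mem_kerd'd'' {k : ℤ} {z : W} (hz : z ∈ C.kerdTot k) (p q : ℤ) :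
    C.proj p q z ∈ C.kerd'd'' p q := by
  refine ⟨?_, proj_mem p q z⟩
  have key := congrArg C.d' (d'_proj_add_d''_proj hz (p := p) (q := q + 1))
  simpa [d'_d'] using key

theorem proj_mem_of_mem_imdTot {k : ℤ} {z : W} (hz : z ∈ C.imdTot k) (p q : ℤ) :
    C.proj p q z ∈ C.imd' p q ⊔ C.imd'' p q := by
  obtain ⟨w, _, rfl⟩ := hz
  have h1 := proj_dtot (C := C) (p - 1) (q - 1) w
  simp only [sub_add_cancel] at h1
  rw [h1]
  exact add_mem
    (Submodule.mem_sup_left (Submodule.mem_map_of_mem (proj_mem _ _ _)))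
    (Submodule.mem_sup_right (Submodule.mem_map_of_mem (proj_mem _ _ _)))

/-- Aeppli cohomology in bidegree `(p, k - p)`. -/
abbrev Aeppli (C : BiComplex W) (k p : ℤ) : Type _ :=
  quotSub (C.kerd'd'' p (k - p)) (C.imd' p (k - p) ⊔ C.imd'' p (k - p))

/-- The components of a closed element of total degree `k`, as Aeppli classes. -/
noncomputable def toAeppli (C : BiComplex W) (k : ℤ) (S : Finset ℤ) :
    C.kerdTot k →ₗ[ℂ] ((p : S) → C.Aeppli k p) :=
  LinearMap.pi fun p => Submodule.mkQ _ ∘ₗ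
    (C.proj p (k - p)).restrict (q := C.kerd'd'' p (k - p))
      (fun _ hz => proj_mem_kerd'd'' hz p (k - p))

theorem toAeppli_apply_eq_mk_iff {k : ℤ} {S : Finset ℤ} {z : C.kerdTot k} {p : S}
    {c : C.kerd'd'' p (k - p)} :
    C.toAeppli k S z p = Submodule.Quotient.mk c ↔
      C.proj p (k - p) z - c ∈ C.imd' p (k - p) ⊔ C.imd'' p (k - p) :=
  Submodule.Quotient.eq _

theorem AeppliInjective.aeppliSurjective (hbd : C.TotallyBounded) {k : ℤ}
    (h : C.AeppliInjective k)
    (hAfin : ∀ p, FiniteDimensional ℂ (C.Aeppli k p))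
    (heq : (∑ᶠ p : ℤ, Module.finrank ℂ (C.Aeppli k p)) =
      Module.finrank ℂ (quotSub (C.kerdTot k) (C.imdTot k))) :
    C.AeppliSurjective k := by
  obtain ⟨N, hN⟩ := hbd
  let S := Finset.Icc (-(N : ℤ)) N
  have hS : ∀ p ∉ S, ∀ q, C.A p q = ⊥ := fun p hp q =>
    hN p q (Or.inl (by rw [Finset.mem_Icc, ← abs_le] at hp; omega))
  have hker : LinearMap.ker (C.toAeppli k S) =
      Submodule.comap (C.kerdTot k).subtype (C.imdTot k) := by
    ext z
    have hz0 : ∀ p : S, C.toAeppli k S z p = 0 ↔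
        C.proj p (k - p) z ∈ C.imd' p (k - p) ⊔ C.imd'' p (k - p) := fun p => by
      simpa using toAeppli_apply_eq_mk_iff (z := z) (p := p) (c := 0)
    rw [LinearMap.mem_ker, funext_iff, Submodule.mem_comap]
    constructor
    · intro hz
      refine h z z.2 fun p q hpq => ?_
      obtain rfl : q = k - p := by omega
      by_cases hp : p ∈ S
      · exact (hz0 ⟨p, hp⟩).1 (hz ⟨p, hp⟩)
      · have h0 := proj_mem (C := C) p (k - p) z
        rw [hS p hp, Submodule.mem_bot] at h0
        rw [h0]
        exact zero_mem _
    · intro hz p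
      exact (hz0 p).2 (proj_mem_of_mem_imdTot hz _ _)
  have hsum : (∑ᶠ p : ℤ, Module.finrank ℂ (C.Aeppli k p)) =
      Module.finrank ℂ ((p : S) → C.Aeppli k p) := by
    rw [Module.finrank_pi_fintype,
      Finset.sum_coe_sort S (fun p => Module.finrank ℂ (C.Aeppli k p))]
    refine finsum_eq_sum_of_support_subset _ fun p hp => ?_
    by_contra hpS
    refine hp ?_
    have : Subsingleton (C.kerd'd'' p (k - p)) := by
      rw [Submodule.subsingleton_iff_eq_bot, kerd'd'', hS p hpS, inf_bot_eq]
    exact Module.finrank_zero_of_subsingleton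
  have hsurj : LinearMap.range (C.toAeppli k S) = ⊤ := by
    apply Submodule.eq_top_of_finrank_eq
    exact (C.toAeppli k S).quotKerEquivRange.finrank_eq.symm.trans <|
      (Submodule.quotEquivOfEq _ _ hker).finrank_eq.trans <| heq.symm.trans hsum
  intro c hc
  obtain ⟨z, hz⟩ := LinearMap.range_eq_top.1 hsurj
    fun p => Submodule.Quotient.mk ⟨c p, hc p (k - p) (by ring)⟩
  refine ⟨z, z.2, fun p q hpq => ?_⟩
  obtain rfl : q = k - p := by omega
  by_cases hp : p ∈ S
  · exact (toAeppli_apply_eq_mk_iff (p := ⟨p, hp⟩) (c := ⟨c p, hc p (k - p) (by ring)⟩)).1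
      (congrFun hz ⟨p, hp⟩)
  · have h0 := sub_mem (proj_mem (C := C) p (k - p) z) (hc p (k - p) (by ring)).2
    rw [hS p hp, Submodule.mem_bot] at h0
    rw [h0]
    exact zero_mem _

theorem TotallyBounded.exists_Atot_eq_bot (hbd : C.TotallyBounded) :
    ∃ m : ℤ, ∀ k ≤ m, C.Atot k = ⊥ := by
  obtain ⟨N, hN⟩ := hbd
  refine ⟨-(2 * N + 1), fun k hk => ?_⟩
  refine iSup_eq_bot.2 fun p => hN _ _ ?_
  by_contra! hcon
  rw [abs_le, abs_le] at hcon
  omega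

theorem ddLemmaAt_of_ddImage (h : ∀ k, C.DDImage k) (p q : ℤ) : C.DDLemmaAt p q := by
  constructor
  · ext y
    constructor
    · rintro ⟨⟨x, hx, rfl⟩, hy, -⟩
      have hy : C.d'' (C.d' x) = 0 := hy
      obtain ⟨e, he, hxe⟩ := (h _ (p - 1) q rfl x ⟨by simpa [d''_d'] using hy, hx⟩).1
      exact ⟨e, he, hxe.symm⟩
    · rintro ⟨e, he, rfl⟩
      have hm : C.d'' e ∈ C.A (p - 1) q := by simpa using d''_mem he
      refine ⟨⟨C.d'' e, hm, rfl⟩, ?_, by simpa using d'_mem hm⟩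
      simp [d''_d', d''_d'']
  · ext y
    constructor
    · rintro ⟨⟨hy, -⟩, x, hx, rfl⟩
      obtain ⟨e, he, hxe⟩ := (h _ p (q - 1) rfl x ⟨hy, hx⟩).2
      exact ⟨e, he, hxe.symm⟩
    · rintro ⟨e, he, rfl⟩
      have hm : C.d' e ∈ C.A p (q - 1) := by simpa using d'_mem he
      have hm' : C.d'' (C.d' e) ∈ C.A p q := by simpa using d''_mem hm
      have hd : (C.d' ∘ₗ C.d'') e = C.d'' (-C.d' e) := by simp [d''_d']
      refine ⟨⟨by simp [d'_d'], ?_⟩, -C.d' e, neg_mem hm, hd.symm⟩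
      rw [hd, map_neg]
      exact neg_mem hm'

end BiComplex

/-- Let `(A^{p,q}, d', d'')` be a totally bounded double complex
of complex vector spaces.  If every `H_A^{p,q}` and every total cohomology `H^k`
is finite dimensional, and `Σ_{p+q=k} dim H_A^{p,q} = dim H^k` for every `k`,
then the double complex satisfies the `d'd''`-lemma. -/
theorem bicomplex_dim_A_eq_betti_implies_ddlemma
    {W : Type*} [AddCommGroup W] [Module ℂ W] (C : BiComplex W)
    (hbd : C.TotallyBounded)
    (hAfin : ∀ p q : ℤ, FiniteDimensional ℂ
      (quotSub (C.kerd'd'' p q) (C.imd' p q ⊔ C.imd'' p q)))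
    (hHfin : ∀ k : ℤ, FiniteDimensional ℂ (quotSub (C.kerdTot k) (C.imdTot k)))
    (heq : ∀ k : ℤ,
      (∑ᶠ p : ℤ, Module.finrank ℂ
          (quotSub (C.kerd'd'' p (k - p))
            (C.imd' p (k - p) ⊔ C.imd'' p (k - p)))) =
        Module.finrank ℂ (quotSub (C.kerdTot k) (C.imdTot k))) :
    ∀ p q : ℤ, C.DDLemmaAt p q := by
  obtain ⟨m, hm⟩ := hbd.exists_Atot_eq_bot
  have himage : ∀ k, C.AeppliInjective k → C.DDImage k := fun k h =>
    (h.aeppliSurjective hbd (fun p => hAfin p (k - p)) (heq k)).ddImage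
  have hsmall : ∀ k ≤ m, C.AeppliInjective k := by
    intro k hk z hz _
    have h0 : z ∈ C.Atot k := hz.2
    rw [hm k hk, Submodule.mem_bot] at h0
    rw [h0]
    exact zero_mem _
  have hlarge : ∀ k, m ≤ k → C.AeppliInjective k := fun k hk =>
    Int.leInduction (motive := fun k _ => C.AeppliInjective k) (hsmall m le_rfl)
      (fun k _ ih => (himage k ih).aeppliInjective_succ hbd) k hk
  exact BiComplex.ddLemmaAt_of_ddImage fun k =>
    himage k ((le_total k m).elim (hsmall k) (hlarge k))
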